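/- arXiv:2505.11259 — 2 statements merged into one kernel-verified Lean document; each statement's English description precedes it below -/
import Mathlib

section
/- Let P ⊆ E and Q ⊆ F be polytopes, each with at least two vertices, in finite-dimensional real inner product spaces. Then the pyramidal width of the product satisfies δ(P × Q) = δ(P)·δ(Q)/√(δ(P)² + δ(Q)²), where P × Q is taken in E × F with the ℓ² product norm. -/
section Defs

variable {E : Type*} [NormedAddCommGroup E] [InnerProductSpace ℝ E]

/-- The (Euclidean) distance between two sets. -/
noncomputable def setDist {X : Type*} [PseudoMetricSpace X] (A B : Set X) : ℝ :=
  sInf ((fun p : X × X => dist p.1 p.2) '' (A ×ˢ B))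

/-- A polytope: the convex hull of a nonempty finite set of points. -/
def IsPolytope (S : Set E) : Prop :=
  ∃ V : Set E, V.Finite ∧ V.Nonempty ∧ S = convexHull ℝ V

/-- A face of `P`: a nonempty proper exposed face. -/
def IsFaceOf (P f : Set E) : Prop :=
  IsExposed ℝ P f ∧ f.Nonempty ∧ f ≠ P

/-- `P^f = conv(V(P) \ V(f))`, where `V(·)` denotes the set of extreme points. -/
noncomputable def compPoly (P f : Set E) : Set E :=
  convexHull ℝ (P.extremePoints ℝ \ f.extremePoints ℝ)

/-- The pyramidal width `δ(P) = min over faces f of dist(f, P^f)`. -/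
noncomputable def pyramidalWidth (P : Set E) : ℝ :=
  sInf {d : ℝ | ∃ f : Set E, IsFaceOf P f ∧ d = setDist f (compPoly P f)}

end Defs

open scoped InnerProductSpace

/-- **Farkas' lemma** for finitely many vectors of a real inner product space. -/
theorem exists_nonneg_sum_smul_of_inner_le_zero {ι E : Type*} [NormedAddCommGroup E]
    [InnerProductSpace ℝ E] (s : Finset ι) (a : ι → E) (b : E)
    (h : ∀ y : E, (∀ i ∈ s, ⟪a i, y⟫_ℝ ≤ 0) → ⟪b, y⟫_ℝ ≤ 0) :
    ∃ c : ι → ℝ, (∀ i, 0 ≤ c i) ∧ b = ∑ i ∈ s, c i • a i := by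
  classical
  induction s using Finset.induction_on generalizing a b with
  | empty =>
    refine ⟨0, fun _ => le_rfl, ?_⟩
    simpa using le_antisymm (h b (by simp)) real_inner_self_nonneg
  | insert j s hj ih =>
    by_cases hs : ∀ y : E, (∀ i ∈ s, ⟪a i, y⟫_ℝ ≤ 0) → ⟪b, y⟫_ℝ ≤ 0
    · obtain ⟨c, hc, hb⟩ := ih a b hs
      refine ⟨Function.update c j 0, fun i => ?_, ?_⟩
      · by_cases hij : i = j
        · simp [hij]
        · simpa [hij] using hc i
      · rw [Finset.sum_insert hj, hb]
        simp only [Function.update_self, zero_smul, zero_add]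
        refine Finset.sum_congr rfl fun i hi => ?_
        rw [Function.update_of_ne (by rintro rfl; exact hj hi)]
    · push Not at hs
      obtain ⟨y₀, hy₀, hby₀⟩ := hs
      have haj : 0 < ⟪a j, y₀⟫_ℝ := by
        by_contra hle
        refine absurd (h y₀ fun i hi => ?_) hby₀.not_ge
        rcases Finset.mem_insert.1 hi with rfl | hi
        exacts [not_lt.1 hle, hy₀ i hi]
      set r := ⟪a j, y₀⟫_ℝ with hr
      obtain ⟨c, hc, hb⟩ := ih (fun i => a i - (⟪a i, y₀⟫_ℝ / r) • a j)
        (b - (⟪b, y₀⟫_ℝ / r) • a j) (by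
          intro y hy
          have key : ∀ v : E, ⟪v - (⟪v, y₀⟫_ℝ / r) • a j, y⟫_ℝ
              = ⟪v, y - (⟪a j, y⟫_ℝ / r) • y₀⟫_ℝ := by
            intro v
            simp only [inner_sub_left, inner_sub_right, real_inner_smul_left,
              real_inner_smul_right]
            ring
          rw [key]
          refine h _ fun i hi => ?_
          rcases Finset.mem_insert.1 hi with rfl | hi
          · rw [inner_sub_right, real_inner_smul_right, ← hr, div_mul_cancel₀ _ haj.ne', sub_self]
          · rw [← key]
            exact hy i hi)
      set k : ℝ := ⟪b, y₀⟫_ℝ / r - ∑ i ∈ s, c i * (⟪a i, y₀⟫_ℝ / r) with hk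
      have hk0 : 0 ≤ k := by
        have h1 : ∑ i ∈ s, c i * (⟪a i, y₀⟫_ℝ / r) ≤ 0 :=
          Finset.sum_nonpos fun i hi => mul_nonpos_of_nonneg_of_nonpos (hc i)
            (div_nonpos_of_nonpos_of_nonneg (hy₀ i hi) haj.le)
        have h2 : 0 ≤ ⟪b, y₀⟫_ℝ / r := by positivity
        linarith
      refine ⟨Function.update c j k, fun i => ?_, ?_⟩
      · by_cases hij : i = j
        · simpa [hij] using hk0
        · simpa [hij] using hc i
      · rw [Finset.sum_insert hj, Function.update_self,
          Finset.sum_congr rfl (g := fun i => c i • a i) fun i hi => by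
            rw [Function.update_of_ne (by rintro rfl; exact hj hi)]]
        simp only [smul_sub, Finset.sum_sub_distrib, smul_smul, ← Finset.sum_smul] at hb
        rw [hk, sub_smul, ← sub_eq_zero]
        rw [← sub_eq_zero] at hb
        rw [← hb]
        abel

/-- Every point `p` of a convex hull of finitely many points lies in an exposed face all of whose
generators `v` occur with positive weight in a representation of `p`. -/
theorem exists_isExposed_forall_mem_openSegment {E : Type*} [NormedAddCommGroup E]
    [InnerProductSpace ℝ E] {V : Set E} (hV : V.Finite) {p : E} (hp : p ∈ convexHull ℝ V) :
    ∃ f : Set E, IsExposed ℝ (convexHull ℝ V) f ∧ p ∈ f ∧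
      ∀ v ∈ V ∩ f, ∃ q ∈ convexHull ℝ V, p ∈ openSegment ℝ v q := by
  classical
  have key : ∀ v : E, ∃ y : E, (∀ w ∈ V, ⟪w - p, y⟫_ℝ ≤ 0) ∧ (v ∈ V → ⟪v - p, y⟫_ℝ = 0 →
      ∃ q ∈ convexHull ℝ V, p ∈ openSegment ℝ v q) := by
    intro v
    by_cases h : ∀ y : E, (∀ w ∈ hV.toFinset, ⟪w - p, y⟫_ℝ ≤ 0) → ⟪p - v, y⟫_ℝ ≤ 0
    · obtain ⟨c, hc, hb⟩ := exists_nonneg_sum_smul_of_inner_le_zero hV.toFinset (fun w => w - p) _ h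
      refine ⟨0, by simp, fun hv _ => ?_⟩
      set k := ∑ w ∈ hV.toFinset, c w with hk
      have hk0 : 0 ≤ k := Finset.sum_nonneg fun w _ => hc w
      simp only [smul_sub, Finset.sum_sub_distrib, ← Finset.sum_smul] at hb
      have hq : (1 + k)⁻¹ • (p + ∑ w ∈ hV.toFinset, c w • w) ∈ convexHull ℝ V := by
        rcases hk0.eq_or_lt with h0 | h0
        · have : ∑ w ∈ hV.toFinset, c w • w = 0 := Finset.sum_eq_zero fun w hw => by
            rw [(Finset.sum_eq_zero_iff_of_nonneg fun w _ => hc w).1 h0.symm w hw, zero_smul]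
          simpa [← h0, this] using hp
        · have hm := (convex_convexHull ℝ V).centerMass_mem (t := hV.toFinset) (w := c) (z := id)
            (fun w _ => hc w) h0 fun w hw => subset_convexHull ℝ V (hV.mem_toFinset.1 hw)
          have := (convex_convexHull ℝ V) hp hm (a := (1 + k)⁻¹) (b := (1 + k)⁻¹ * k)
            (by positivity) (by positivity) (by field_simp)
          convert this using 1
          rw [Finset.centerMass, ← hk, smul_smul, smul_add, mul_assoc, mul_inv_cancel₀ h0.ne',
            mul_one]
          rfl
      refine ⟨_, hq, (2 + k)⁻¹, (2 + k)⁻¹ * (1 + k), by positivity, by positivity,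
        by field_simp; ring, ?_⟩
      rw [smul_smul, mul_assoc, mul_inv_cancel₀ (by positivity), mul_one, ← smul_add,
        inv_smul_eq_iff₀ (by positivity)]
      rw [← hk] at hb
      rw [add_smul, two_smul, eq_add_of_sub_eq hb.symm]
      abel
    · push Not at h
      obtain ⟨y, hy, hvy⟩ := h
      refine ⟨y, fun w hw => hy w (hV.mem_toFinset.2 hw), fun _ h0 => ?_⟩
      rw [← neg_sub, inner_neg_left, h0] at hvy
      simp at hvy
  choose y hy hyv using key
  set Y := ∑ v ∈ hV.toFinset, y v with hY
  have hYV : ∀ w ∈ convexHull ℝ V, ⟪Y, w⟫_ℝ ≤ ⟪Y, p⟫_ℝ := by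
    refine fun w hw => convexHull_min (t := {w | ⟪Y, w⟫_ℝ ≤ ⟪Y, p⟫_ℝ}) (fun w hw => ?_)
      (convex_halfSpace_le (innerSL ℝ Y).isBoundedLinearMap.toIsLinearMap _) hw
    have : ⟪w - p, Y⟫_ℝ ≤ 0 := by
      rw [hY, inner_sum]
      exact Finset.sum_nonpos fun v _ => hy v w hw
    rw [real_inner_comm, inner_sub_right] at this
    simpa using this
  refine ⟨(innerSL ℝ Y).toExposed _, ContinuousLinearMap.toExposed.isExposed,
    ⟨hp, fun w hw => by simpa using hYV w hw⟩, ?_⟩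
  rintro v ⟨hv, -, hvY⟩
  refine hyv v hv ?_
  have h0 : ⟪v - p, Y⟫_ℝ = 0 := by
    rw [real_inner_comm, inner_sub_right, sub_eq_zero]
    exact le_antisymm (hYV v (subset_convexHull ℝ V hv)) (by simpa using hvY p hp)
  rw [hY, inner_sum] at h0
  exact (Finset.sum_eq_zero_iff_of_nonpos fun w _ => hy w v hv).1 h0 v (hV.mem_toFinset.2 hv)

/-- A point of the convex hull of a finite set either lies in the convex hull of the generators
outside `W`, or gives positive weight to some generator in `W`. -/
theorem mem_convexHull_diff_or_exists_mem_openSegment {E : Type*} [AddCommGroup E] [Module ℝ E]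
    {V : Set E} (hV : V.Finite) (W : Set E) {x : E} (hx : x ∈ convexHull ℝ V) :
    x ∈ convexHull ℝ (V \ W) ∨
      ∃ v ∈ V ∩ W, ∃ y ∈ convexHull ℝ V, x ∈ openSegment ℝ v y := by
  classical
  lift V to Finset E using hV
  obtain ⟨c, hc, hc1, rfl⟩ := Finset.mem_convexHull'.1 hx
  by_cases h : ∃ v ∈ V, v ∈ W ∧ 0 < c v
  · obtain ⟨v, hv, hvW, hcv⟩ := h
    have hcv1 : c v ≤ 1 := hc1 ▸ Finset.single_le_sum hc hv
    refine Or.inr ⟨v, ⟨hv, hvW⟩, (1 - c v / 2)⁻¹ • ((∑ y ∈ V, c y • y) - (c v / 2) • v), ?_,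
      c v / 2, 1 - c v / 2, by positivity, by linarith, by ring, ?_⟩
    · have hsum : ∑ y ∈ V, (c y - if y = v then c v / 2 else 0) = 1 - c v / 2 := by
        simp [Finset.sum_sub_distrib, hc1, hv]
      have hm := (convex_convexHull ℝ (V : Set E)).centerMass_mem (t := V)
        (w := fun y => c y - if y = v then c v / 2 else 0) (z := id)
        (fun y hy => by
          split_ifs with hyv
          · rw [hyv]; linarith
          · simpa using hc y hy) (by rw [hsum]; linarith)
        fun y hy => subset_convexHull ℝ _ hy
      convert hm using 1
      rw [Finset.centerMass, hsum]
      simp [sub_smul, Finset.sum_sub_distrib, ite_smul, hv]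
    · rw [smul_smul, mul_inv_cancel₀ (by linarith), one_smul]
      abel
  · push Not at h
    refine Or.inl ?_
    have h0 : ∀ v ∈ V, v ∉ V.filter (· ∉ W) → c v = 0 := fun v hv hvn =>
      le_antisymm (h v hv (by simpa [hv] using hvn)) (hc v hv)
    have hs1 : ∑ y ∈ V.filter (· ∉ W), c y = 1 := by
      rw [← hc1]
      exact Finset.sum_subset (Finset.filter_subset _ _) h0
    rw [← Finset.sum_subset (Finset.filter_subset (· ∉ W) V) fun v hv hvn => by
      rw [h0 v hv hvn, zero_smul]]
    refine (convex_convexHull ℝ _).sum_mem (fun v hv => hc v (Finset.filter_subset _ _ hv)) hs1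
      fun v hv => subset_convexHull ℝ _ ?_
    simpa using hv

/-- Removing a small multiple of `v` from a multiple of a convex combination of `v` and `y`. -/
theorem exists_smul_sub_smul_eq {E : Type*} [AddCommGroup E] [Module ℝ E] {C : Set E}
    (hC : Convex ℝ C) {v y : E} (hv : v ∈ C) (hy : y ∈ C) {a s η : ℝ} (ha : a < 1)
    (hs : 0 < s) (hη : η ≤ s * a) :
    ∃ z ∈ C, s • (a • v + (1 - a) • y) - η • v = (s - η) • z := by
  have hlt : 0 < s - η := by nlinarith
  refine ⟨((s * a - η) / (s - η)) • v + (s * (1 - a) / (s - η)) • y, hC hv hy ?_ ?_ ?_, ?_⟩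
  · exact div_nonneg (by linarith) hlt.le
  · exact div_nonneg (mul_nonneg hs.le (by linarith)) hlt.le
  · field_simp
    ring
  · rw [smul_add (s - η), smul_smul (s - η), smul_smul (s - η), mul_div_cancel₀ _ hlt.ne',
      mul_div_cancel₀ _ hlt.ne']
    module

theorem IsPolytope.isCompact {E : Type*} [NormedAddCommGroup E] [InnerProductSpace ℝ E]
    {P : Set E} (hP : IsPolytope P) : IsCompact P := by
  obtain ⟨V, hV, -, rfl⟩ := hP
  exact hV.isCompact_convexHull ℝ

theorem IsPolytope.convex {E : Type*} [NormedAddCommGroup E] [InnerProductSpace ℝ E]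
    {P : Set E} (hP : IsPolytope P) : Convex ℝ P := by
  obtain ⟨V, -, -, rfl⟩ := hP
  exact convex_convexHull ℝ V

theorem IsPolytope.finite_extremePoints {E : Type*} [NormedAddCommGroup E]
    [InnerProductSpace ℝ E] {P : Set E} (hP : IsPolytope P) : (P.extremePoints ℝ).Finite := by
  obtain ⟨V, hV, -, rfl⟩ := hP
  exact hV.subset extremePoints_convexHull_subset

theorem IsPolytope.convexHull_extremePoints {E : Type*} [NormedAddCommGroup E]
    [InnerProductSpace ℝ E] {P : Set E} (hP : IsPolytope P) :
    convexHull ℝ (P.extremePoints ℝ) = P := by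
  rw [← (hP.finite_extremePoints.isClosed_convexHull ℝ).closure_eq]
  exact closure_convexHull_extremePoints hP.isCompact hP.convex

theorem IsExposed.compPoly_eq {E : Type*} [NormedAddCommGroup E] [InnerProductSpace ℝ E]
    {P f : Set E} (hf : IsExposed ℝ P f) :
    compPoly P f = convexHull ℝ (P.extremePoints ℝ \ f) := by
  rw [compPoly, hf.isExtreme.extremePoints_eq, Set.inter_comm, Set.sdiff_self_inter]

theorem setDist_nonneg {X : Type*} [PseudoMetricSpace X] (A B : Set X) : 0 ≤ setDist A B := by
  refine Real.sInf_nonneg ?_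
  rintro _ ⟨p, -, rfl⟩
  exact dist_nonneg

theorem setDist_le_dist {X : Type*} [PseudoMetricSpace X] {A B : Set X} {x y : X} (hx : x ∈ A)
    (hy : y ∈ B) : setDist A B ≤ dist x y := by
  refine csInf_le ⟨0, ?_⟩ ⟨(x, y), ⟨hx, hy⟩, rfl⟩
  rintro _ ⟨p, -, rfl⟩
  exact dist_nonneg

theorem IsPolytope.compPoly_nonempty {E : Type*} [NormedAddCommGroup E] [InnerProductSpace ℝ E]
    {P f : Set E} (hP : IsPolytope P) (hf : IsFaceOf P f) : (compPoly P f).Nonempty := by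
  rw [hf.1.compPoly_eq, convexHull_nonempty_iff, Set.sdiff_nonempty]
  intro hsub
  refine hf.2.2 (hf.1.subset.antisymm ?_)
  rw [← hP.convexHull_extremePoints]
  exact convexHull_min hsub (hf.1.convex hP.convex)

theorem pyramidalWidth_nonneg {E : Type*} [NormedAddCommGroup E] [InnerProductSpace ℝ E]
    (P : Set E) : 0 ≤ pyramidalWidth P := by
  refine Real.sInf_nonneg ?_
  rintro _ ⟨f, -, rfl⟩
  exact setDist_nonneg _ _

theorem IsFaceOf.pyramidalWidth_le_dist {E : Type*} [NormedAddCommGroup E]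
    [InnerProductSpace ℝ E] {P f : Set E} (hf : IsFaceOf P f) {x u : E} (hx : x ∈ f)
    (hu : u ∈ compPoly P f) : pyramidalWidth P ≤ dist x u := by
  refine le_trans (csInf_le ⟨0, ?_⟩ ⟨f, hf, rfl⟩) (setDist_le_dist hx hu)
  rintro _ ⟨f, -, rfl⟩
  exact setDist_nonneg _ _

theorem IsPolytope.exists_isFaceOf {E : Type*} [NormedAddCommGroup E] [InnerProductSpace ℝ E]
    {P : Set E} (hP : IsPolytope P) (hPn : P.Nontrivial) : ∃ f, IsFaceOf P f := by
  obtain ⟨a, ha, b, hb, hab⟩ := hPn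
  obtain ⟨x, hx, hmax⟩ := hP.isCompact.exists_isMaxOn ⟨a, ha⟩
    (innerSL ℝ (a - b)).continuous.continuousOn
  refine ⟨(innerSL ℝ (a - b)).toExposed P, ContinuousLinearMap.toExposed.isExposed,
    ⟨x, hx, hmax⟩, fun h => ?_⟩
  have h1 : ⟪a - b, a⟫_ℝ ≤ ⟪a - b, b⟫_ℝ := by
    exact (h.symm ▸ hb : b ∈ (innerSL ℝ (a - b)).toExposed P).2 a ha
  rw [← sub_nonpos, ← inner_sub_right] at h1
  exact hab (sub_eq_zero.1 (inner_self_eq_zero.1 (h1.antisymm real_inner_self_nonneg)))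

/-- The pyramidal width is a limit of distances between points of a face `f` and of `P^f`. -/
theorem IsPolytope.pyramidalWidth_mem_closure {E : Type*} [NormedAddCommGroup E]
    [InnerProductSpace ℝ E] {P : Set E} (hP : IsPolytope P) (hPf : ∃ f, IsFaceOf P f) :
    pyramidalWidth P ∈
      closure {d : ℝ | ∃ f x u, IsFaceOf P f ∧ x ∈ f ∧ u ∈ compPoly P f ∧ d = dist x u} := by
  obtain ⟨f₀, hf₀⟩ := hPf
  refine closure_minimal ?_ isClosed_closure
    (csInf_mem_closure (s := {d : ℝ | ∃ f, IsFaceOf P f ∧ d = setDist f (compPoly P f)})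
      ⟨_, f₀, hf₀, rfl⟩ ⟨0, ?_⟩)
  · rintro _ ⟨f, hf, rfl⟩
    refine closure_mono ?_ (csInf_mem_closure
      (((hf.2.1.prod (hP.compPoly_nonempty hf)).image _)) ⟨0, ?_⟩)
    · rintro _ ⟨⟨x, u⟩, ⟨hx, hu⟩, rfl⟩
      exact ⟨f, x, u, hf, hx, hu, rfl⟩
    · rintro _ ⟨p, -, rfl⟩
      exact dist_nonneg
  · rintro _ ⟨f, -, rfl⟩
    exact setDist_nonneg _ _

/-- A point carrying mass `t` on `P^f` is at distance at least `t * δ(P)` from the face `f`. -/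
theorem IsPolytope.mul_pyramidalWidth_le_norm {E : Type*} [NormedAddCommGroup E]
    [InnerProductSpace ℝ E] {P f : Set E} (hP : IsPolytope P) (hf : IsExposed ℝ P f)
    {p u x : E} (hp : p ∈ f) (hu : u ∈ compPoly P f) (hx : x ∈ P) {t : ℝ} (ht : 0 ≤ t)
    (ht1 : t ≤ 1) : t * pyramidalWidth P ≤ ‖t • u + (1 - t) • x - p‖ := by
  rcases ht.eq_or_lt with rfl | ht
  · simp
  have hV := hP.finite_extremePoints
  have hVP := hP.convexHull_extremePoints
  set d := t • u + (1 - t) • x - p with hd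
  let K : Set (ℝ × E × E) := (Set.Icc 0 (1 - t) ×ˢ P ×ˢ f) ∩
    {z | d = t • u + z.1 • z.2.1 - (t + z.1) • z.2.2}
  have hK : IsCompact K :=
    (isCompact_Icc.prod (hP.isCompact.prod (hf.isCompact hP.isCompact))).inter_right
      (isClosed_eq continuous_const (by fun_prop))
  obtain ⟨⟨s, x', p'⟩, ⟨⟨⟨hs0, hs1⟩, hx', hp'⟩, hdz⟩, hmin⟩ := hK.exists_isMinOn
    ⟨(1 - t, x, p), ⟨⟨sub_nonneg.2 ht1, le_rfl⟩, hx, hp⟩, by simp [hd]⟩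
    continuous_fst.continuousOn
  simp only [Set.mem_ofPred_eq] at hdz
  obtain ⟨g, hg, hpg, hseg⟩ := exists_isExposed_forall_mem_openSegment hV
    (hVP.symm ▸ hf.subset hp' : p' ∈ convexHull ℝ (P.extremePoints ℝ))
  rw [hVP] at hg hseg
  have hug : u ∈ convexHull ℝ (P.extremePoints ℝ \ g) := by
    rw [hf.compPoly_eq] at hu
    refine convexHull_mono ?_ hu
    rintro v ⟨hv, hvf⟩
    refine ⟨hv, fun hvg => hvf ?_⟩
    obtain ⟨q, hq, hpq⟩ := hseg v ⟨hv, hvg⟩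
    exact hf.isExtreme.left_mem_of_mem_openSegment hv.1 hq hp' hpq
  have hxg : s = 0 ∨ x' ∈ convexHull ℝ (P.extremePoints ℝ \ g) := by
    refine hs0.eq_or_lt.imp Eq.symm fun hs => ?_
    refine (mem_convexHull_diff_or_exists_mem_openSegment hV g
      (hVP.symm ▸ hx')).resolve_right ?_
    rintro ⟨v, hv, y, hy, b, b', hb, hb', hbb, hxb⟩
    rw [hVP] at hy
    obtain ⟨q, hq, hpq⟩ := hseg v hv
    have hvf := hf.isExtreme.left_mem_of_mem_openSegment hv.1.1 hq hp' hpq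
    have hqf := hf.isExtreme.left_mem_of_mem_openSegment hq hv.1.1 hp'
      (openSegment_symm ℝ v q ▸ hpq)
    obtain ⟨e, e', he, he', hee, hpe⟩ := hpq
    obtain rfl : b' = 1 - b := by linarith
    obtain rfl : e' = 1 - e := by linarith
    have hη : 0 < min (s * b) ((t + s) * e) := by positivity
    obtain ⟨x₁, hx₁, hxx⟩ := exists_smul_sub_smul_eq hP.convex hv.1.1 hy (by linarith) hs
      (min_le_left (s * b) ((t + s) * e))
    obtain ⟨p₁, hp₁, hpp⟩ := exists_smul_sub_smul_eq (hf.convex hP.convex) hvf hqf (a := e)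
      (by linarith) (by linarith : 0 < t + s) (min_le_right (s * b) ((t + s) * e))
    set η := min (s * b) ((t + s) * e) with hηdef
    have hηs : η ≤ s := (min_le_left _ _).trans (by nlinarith)
    rw [hxb] at hxx
    rw [hpe] at hpp
    have hle : s ≤ s - η := hmin (a := (s - η, x₁, p₁))
      ⟨⟨⟨by linarith, by linarith⟩, hx₁, hp₁⟩, by
        change d = t • u + (s - η) • x₁ - (t + (s - η)) • p₁
        rw [← add_sub_assoc, ← hxx, ← hpp, hdz]
        abel⟩
    linarith
  have hts : 0 < t + s := by linarith
  set z := (t / (t + s)) • u + (s / (t + s)) • x' with hz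
  have hzg : z ∈ compPoly P g := by
    rw [hg.compPoly_eq]
    rcases hxg with rfl | hxg
    · simpa [hz, ht.ne'] using hug
    · exact convex_convexHull ℝ _ hug hxg (by positivity) (by positivity) (by field_simp)
  have hgP : IsFaceOf P g := by
    refine ⟨hg, ⟨p', hpg⟩, ?_⟩
    rintro rfl
    rw [Set.sdiff_eq_empty.2 extremePoints_subset, convexHull_empty] at hug
    exact hug
  have hdn : d = (t + s) • (z - p') := by
    rw [hdz, hz, smul_sub, smul_add, smul_smul, smul_smul, mul_div_cancel₀ _ hts.ne',
      mul_div_cancel₀ _ hts.ne']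
  have hle := hgP.pyramidalWidth_le_dist hpg hzg
  rw [dist_comm, dist_eq_norm] at hle
  rw [hdn, norm_smul, Real.norm_of_nonneg hts.le]
  exact mul_le_mul (by linarith) hle (pyramidalWidth_nonneg P) hts.le

/-- The product of two sets, as a subset of the `ℓ²` product. -/
def l2Prod {E F : Type*} (A : Set E) (B : Set F) : Set (WithLp 2 (E × F)) :=
  (WithLp.equiv 2 (E × F)).symm '' (A ×ˢ B)

theorem mem_l2Prod {E F : Type*} {A : Set E} {B : Set F} {z : WithLp 2 (E × F)} :
    z ∈ l2Prod A B ↔ z.fst ∈ A ∧ z.snd ∈ B := by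
  rw [l2Prod, Equiv.image_symm_eq_preimage]
  rfl

theorem toLp_mem_l2Prod {E F : Type*} {A : Set E} {B : Set F} {x : E} {y : F} (hx : x ∈ A)
    (hy : y ∈ B) : WithLp.toLp 2 (x, y) ∈ l2Prod A B :=
  mem_l2Prod.2 ⟨hx, hy⟩

section

variable {E F : Type*} [NormedAddCommGroup E] [InnerProductSpace ℝ E]
  [NormedAddCommGroup F] [InnerProductSpace ℝ F]

theorem l2Prod_eq_image (A : Set E) (B : Set F) :
    l2Prod A B = (WithLp.linearEquiv 2 ℝ (E × F)).symm '' (A ×ˢ B) := rfl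

theorem extremePoints_l2Prod (A : Set E) (B : Set F) :
    (l2Prod A B).extremePoints ℝ = l2Prod (A.extremePoints ℝ) (B.extremePoints ℝ) := by
  rw [l2Prod_eq_image, ← image_extremePoints, extremePoints_prod, l2Prod_eq_image]

theorem convexHull_l2Prod (A : Set E) (B : Set F) :
    convexHull ℝ (l2Prod A B) = l2Prod (convexHull ℝ A) (convexHull ℝ B) := by
  rw [l2Prod_eq_image, l2Prod_eq_image, ← convexHull_prod]
  exact ((WithLp.linearEquiv 2 ℝ (E × F)).symm.toLinearMap.image_convexHull _).symm

theorem IsPolytope.l2Prod {P : Set E} {Q : Set F} (hP : IsPolytope P) (hQ : IsPolytope Q) :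
    IsPolytope (l2Prod P Q) := by
  obtain ⟨V, hV, hVn, rfl⟩ := hP
  obtain ⟨W, hW, hWn, rfl⟩ := hQ
  exact ⟨_root_.l2Prod V W, (hV.prod hW).image _, (hVn.prod hWn).image _,
    (convexHull_l2Prod V W).symm⟩

theorem IsExposed.l2Prod {P f : Set E} {Q g : Set F} (hf : IsExposed ℝ P f)
    (hg : IsExposed ℝ Q g) : IsExposed ℝ (l2Prod P Q) (l2Prod f g) := by
  rintro ⟨z, hz⟩
  rw [mem_l2Prod] at hz
  obtain ⟨l, rfl⟩ := hf ⟨_, hz.1⟩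
  obtain ⟨m, rfl⟩ := hg ⟨_, hz.2⟩
  refine ⟨l.comp (WithLp.fstL 2 ℝ E F) + m.comp (WithLp.sndL 2 ℝ E F), ?_⟩
  ext w
  simp only [mem_l2Prod, Set.mem_ofPred_eq, add_apply,
    ContinuousLinearMap.comp_apply, WithLp.fstL_apply, WithLp.sndL_apply]
  constructor
  · rintro ⟨⟨h1, h2⟩, h3, h4⟩
    exact ⟨⟨h1, h3⟩, fun y hy => add_le_add (h2 _ hy.1) (h4 _ hy.2)⟩
  · rintro ⟨⟨h1, h2⟩, h3⟩
    refine ⟨⟨h1, fun y hy => ?_⟩, h2, fun y hy => ?_⟩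
    · simpa using h3 (WithLp.toLp 2 (y, w.snd)) ⟨hy, h2⟩
    · simpa using h3 (WithLp.toLp 2 (w.fst, y)) ⟨h1, hy⟩

theorem exists_eq_l2Prod_of_isExposed {P : Set E} {Q : Set F} {h : Set (WithLp 2 (E × F))}
    (hh : IsExposed ℝ (l2Prod P Q) h) (hn : h.Nonempty) :
    ∃ f g, IsExposed ℝ P f ∧ IsExposed ℝ Q g ∧ h = l2Prod f g := by
  obtain ⟨l, hl⟩ := hh hn
  let i₁ : E →L[ℝ] WithLp 2 (E × F) :=
    (WithLp.prodContinuousLinearEquiv 2 ℝ E F).symm.toContinuousLinearMap.comp (.inl ℝ E F)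
  let i₂ : F →L[ℝ] WithLp 2 (E × F) :=
    (WithLp.prodContinuousLinearEquiv 2 ℝ E F).symm.toContinuousLinearMap.comp (.inr ℝ E F)
  have hsplit : ∀ x y, l (WithLp.toLp 2 (x, y)) = l (i₁ x) + l (i₂ y) := by
    intro x y
    rw [← map_add]
    simp [i₁, i₂, ← WithLp.toLp_add]
  refine ⟨(l.comp i₁).toExposed P, (l.comp i₂).toExposed Q,
    ContinuousLinearMap.toExposed.isExposed, ContinuousLinearMap.toExposed.isExposed, ?_⟩
  rw [hl]
  ext ⟨x, y⟩
  simp only [mem_l2Prod, Set.mem_ofPred_eq, ContinuousLinearMap.toExposed,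
    ContinuousLinearMap.comp_apply]
  constructor
  · rintro ⟨⟨h1, h2⟩, h3⟩
    refine ⟨⟨h1, fun y' hy => ?_⟩, h2, fun y' hy => ?_⟩
    · have := h3 (WithLp.toLp 2 (y', y)) ⟨hy, h2⟩
      rwa [hsplit y' y, hsplit x y, add_le_add_iff_right] at this
    · have := h3 (WithLp.toLp 2 (x, y')) ⟨h1, hy⟩
      rwa [hsplit x y', hsplit x y, add_le_add_iff_left] at this
  · rintro ⟨⟨h1, h2⟩, h3, h4⟩
    refine ⟨⟨h1, h3⟩, ?_⟩
    rintro ⟨x', y'⟩ hy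
    rw [hsplit x' y', hsplit x y]
    exact add_le_add (h2 _ hy.1) (h4 _ hy.2)

theorem compPoly_l2Prod {P f : Set E} {Q g : Set F} (hf : IsExposed ℝ P f)
    (hg : IsExposed ℝ Q g) :
    compPoly (l2Prod P Q) (l2Prod f g) =
      convexHull ℝ (l2Prod (P.extremePoints ℝ \ f) (Q.extremePoints ℝ) ∪
        l2Prod (P.extremePoints ℝ) (Q.extremePoints ℝ \ g)) := by
  rw [(hf.l2Prod hg).compPoly_eq, extremePoints_l2Prod]
  congr 1
  ext z
  simp only [mem_l2Prod, Set.mem_sdiff, Set.mem_union]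
  tauto

theorem pyramidalWidth_l2Prod_sq_le {P f : Set E} {Q g : Set F} (hf : IsFaceOf P f)
    (hg : IsFaceOf Q g) {x u : E} {y v : F} (hx : x ∈ f) (hu : u ∈ compPoly P f) (hy : y ∈ g)
    (hv : v ∈ compPoly Q g) (hP : IsPolytope P) (hQ : IsPolytope Q) {t : ℝ} (ht : 0 ≤ t)
    (ht1 : t ≤ 1) :
    pyramidalWidth (l2Prod P Q) ^ 2 ≤ t ^ 2 * dist x u ^ 2 + (1 - t) ^ 2 * dist y v ^ 2 := by
  have hface : IsFaceOf (l2Prod P Q) (l2Prod f g) := by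
    refine ⟨hf.1.l2Prod hg.1, ⟨_, toLp_mem_l2Prod hx hy⟩, fun h => hf.2.2 ?_⟩
    refine hf.1.subset.antisymm fun a ha => ?_
    exact (h ▸ toLp_mem_l2Prod ha (hg.1.subset hy) :
      WithLp.toLp 2 (a, y) ∈ l2Prod f g) |> mem_l2Prod.1 |>.1
  have hw : t • WithLp.toLp 2 (u, y) + (1 - t) • WithLp.toLp 2 (x, v) ∈
      compPoly (l2Prod P Q) (l2Prod f g) := by
    rw [compPoly_l2Prod hf.1 hg.1]
    refine convex_convexHull ℝ _ (convexHull_mono Set.subset_union_left ?_)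
      (convexHull_mono Set.subset_union_right ?_) ht (by linarith) (by ring)
    · rw [convexHull_l2Prod, hQ.convexHull_extremePoints, ← hf.1.compPoly_eq]
      exact toLp_mem_l2Prod hu (hg.1.subset hy)
    · rw [convexHull_l2Prod, hP.convexHull_extremePoints, ← hg.1.compPoly_eq]
      exact toLp_mem_l2Prod (hf.1.subset hx) hv
  have hle := hface.pyramidalWidth_le_dist (toLp_mem_l2Prod hx hy) hw
  have hsq := pow_le_pow_left₀ (pyramidalWidth_nonneg _) hle 2
  refine hsq.trans_eq ?_
  have h1 : x - (t • u + (1 - t) • x) = t • (x - u) := by module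
  have h2 : y - (t • y + (1 - t) • v) = (1 - t) • (y - v) := by module
  rw [dist_eq_norm, WithLp.prod_norm_sq_eq_of_L2]
  simp [h1, h2, norm_smul, mul_pow, dist_eq_norm]

theorem exists_pyramidalWidth_sq_le_dist_sq {P : Set E} {Q : Set F} (hP : IsPolytope P)
    (hQ : IsPolytope Q) {h : Set (WithLp 2 (E × F))} (hh : IsFaceOf (l2Prod P Q) h)
    {p z : WithLp 2 (E × F)} (hp : p ∈ h) (hz : z ∈ compPoly (l2Prod P Q) h) :
    ∃ t : ℝ, t ^ 2 * pyramidalWidth P ^ 2 + (1 - t) ^ 2 * pyramidalWidth Q ^ 2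
      ≤ dist p z ^ 2 := by
  obtain ⟨f, g, hf, hg, rfl⟩ := exists_eq_l2Prod_of_isExposed hh.1 hh.2.1
  rw [mem_l2Prod] at hp
  have hPn := pyramidalWidth_nonneg P
  have hQn := pyramidalWidth_nonneg Q
  rw [compPoly_l2Prod hf hg] at hz
  rw [dist_comm, dist_eq_norm, WithLp.prod_norm_sq_eq_of_L2, WithLp.sub_fst, WithLp.sub_snd]
  have hleft : ∀ w ∈ convexHull ℝ (l2Prod (P.extremePoints ℝ \ f) (Q.extremePoints ℝ)),
      w.fst ∈ compPoly P f ∧ w.snd ∈ Q := fun w hw => by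
    rwa [convexHull_l2Prod, hQ.convexHull_extremePoints, ← hf.compPoly_eq, mem_l2Prod] at hw
  have hright : ∀ w ∈ convexHull ℝ (l2Prod (P.extremePoints ℝ) (Q.extremePoints ℝ \ g)),
      w.fst ∈ P ∧ w.snd ∈ compPoly Q g := fun w hw => by
    rwa [convexHull_l2Prod, hP.convexHull_extremePoints, ← hg.compPoly_eq, mem_l2Prod] at hw
  rcases Set.eq_empty_or_nonempty (l2Prod (P.extremePoints ℝ \ f) (Q.extremePoints ℝ))
    with h1 | h1
  · rw [h1, Set.empty_union] at hz
    obtain ⟨hz1, hz2⟩ := hright z hz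
    have := hQ.mul_pyramidalWidth_le_norm hg hp.2 hz2 (hg.subset hp.2) zero_le_one le_rfl
    simp only [one_mul, one_smul, sub_self, zero_smul, add_zero] at this
    exact ⟨0, by nlinarith [sq_nonneg ‖z.fst - p.fst‖]⟩
  rcases Set.eq_empty_or_nonempty (l2Prod (P.extremePoints ℝ) (Q.extremePoints ℝ \ g))
    with h2 | h2
  · rw [h2, Set.union_empty] at hz
    obtain ⟨hz1, hz2⟩ := hleft z hz
    have := hP.mul_pyramidalWidth_le_norm hf hp.1 hz1 (hf.subset hp.1) zero_le_one le_rfl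
    simp only [one_mul, one_smul, sub_self, zero_smul, add_zero] at this
    exact ⟨1, by nlinarith [sq_nonneg ‖z.snd - p.snd‖]⟩
  rw [convexHull_union h1 h2, mem_convexJoin] at hz
  obtain ⟨a, ha, b, hb, t, t', ht, ht', htt, rfl⟩ := hz
  obtain ⟨ha1, ha2⟩ := hleft a ha
  obtain ⟨hb1, hb2⟩ := hright b hb
  obtain rfl : t' = 1 - t := by linarith
  refine ⟨t, ?_⟩
  have k1 := hP.mul_pyramidalWidth_le_norm hf hp.1 ha1 hb1 ht (by linarith)
  have k2 := hQ.mul_pyramidalWidth_le_norm hg hp.2 hb2 ha2 ht' (by linarith)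
  rw [sub_sub_cancel, add_comm (_ • b.snd)] at k2
  rw [← mul_pow, ← mul_pow]
  exact add_le_add (pow_le_pow_left₀ (by positivity) k1 2) (pow_le_pow_left₀ (by positivity) k2 2)

end

theorem div_sqrt_sq_le {a b : ℝ} (t : ℝ) :
    (a * b / √(a ^ 2 + b ^ 2)) ^ 2 ≤ t ^ 2 * a ^ 2 + (1 - t) ^ 2 * b ^ 2 := by
  rw [div_pow, Real.sq_sqrt (by positivity)]
  refine div_le_of_le_mul₀ (by positivity) (by positivity) ?_
  nlinarith [sq_nonneg (t * a ^ 2 - (1 - t) * b ^ 2)]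

theorem exists_mul_sq_add_mul_sq_eq (a b : ℝ) : ∃ t : ℝ, 0 ≤ t ∧ t ≤ 1 ∧
    t ^ 2 * a ^ 2 + (1 - t) ^ 2 * b ^ 2 = (a * b / √(a ^ 2 + b ^ 2)) ^ 2 := by
  rw [div_pow, Real.sq_sqrt (by positivity)]
  by_cases h : a ^ 2 + b ^ 2 = 0
  · obtain ⟨ha, hb⟩ : a ^ 2 = 0 ∧ b ^ 2 = 0 :=
      ⟨by nlinarith [sq_nonneg a, sq_nonneg b], by nlinarith [sq_nonneg a, sq_nonneg b]⟩
    exact ⟨0, le_rfl, zero_le_one, by simp [ha, hb]⟩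
  · refine ⟨b ^ 2 / (a ^ 2 + b ^ 2), by positivity,
      div_le_one_of_le₀ (by nlinarith [sq_nonneg a]) (by positivity), ?_⟩
    field_simp
    ring

/-- Pyramidal width of a product: for polytopes `P ⊆ E` and `Q ⊆ F`, each with at least
two vertices, `δ(P × Q) = δ(P)·δ(Q)/√(δ(P)² + δ(Q)²)`, the product being taken in `E × F`
with the ℓ² product norm. -/
theorem pyramidalWidth_prod
    {E F : Type*} [NormedAddCommGroup E] [InnerProductSpace ℝ E] [FiniteDimensional ℝ E]
    [NormedAddCommGroup F] [InnerProductSpace ℝ F] [FiniteDimensional ℝ F]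
    (P : Set E) (Q : Set F) (hP : IsPolytope P) (hQ : IsPolytope Q)
    (hPv : (P.extremePoints ℝ).Nontrivial) (hQv : (Q.extremePoints ℝ).Nontrivial) :
    pyramidalWidth ((WithLp.equiv 2 (E × F)).symm '' (P ×ˢ Q)) =
      pyramidalWidth P * pyramidalWidth Q /
        Real.sqrt (pyramidalWidth P ^ 2 + pyramidalWidth Q ^ 2) := by
  have hPn := pyramidalWidth_nonneg P
  have hQn := pyramidalWidth_nonneg Q
  obtain ⟨f₀, hf₀⟩ := hP.exists_isFaceOf (hPv.mono extremePoints_subset)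
  obtain ⟨g₀, hg₀⟩ := hQ.exists_isFaceOf (hQv.mono extremePoints_subset)
  change pyramidalWidth (l2Prod P Q) = _
  refine le_antisymm ?_ ?_
  · refine pow_le_pow_iff_left₀ (pyramidalWidth_nonneg _) (by positivity) two_ne_zero |>.1 ?_
    obtain ⟨t, ht, ht1, hteq⟩ :=
      exists_mul_sq_add_mul_sq_eq (pyramidalWidth P) (pyramidalWidth Q)
    rw [← hteq]
    refine closure_minimal (t := {a : ℝ | pyramidalWidth (l2Prod P Q) ^ 2 ≤
      t ^ 2 * a ^ 2 + (1 - t) ^ 2 * pyramidalWidth Q ^ 2}) ?_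
      (isClosed_le continuous_const (by fun_prop)) (hP.pyramidalWidth_mem_closure ⟨f₀, hf₀⟩)
    rintro _ ⟨f, x, u, hf, hx, hu, rfl⟩
    refine closure_minimal (t := {b : ℝ | pyramidalWidth (l2Prod P Q) ^ 2 ≤
      t ^ 2 * dist x u ^ 2 + (1 - t) ^ 2 * b ^ 2}) ?_
      (isClosed_le continuous_const (by fun_prop)) (hQ.pyramidalWidth_mem_closure ⟨g₀, hg₀⟩)
    rintro _ ⟨g, y, v, hg, hy, hv, rfl⟩
    exact pyramidalWidth_l2Prod_sq_le hf hg hx hu hy hv hP hQ ht ht1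
  · have hface : ∃ h, IsFaceOf (l2Prod P Q) h := by
      refine (hP.l2Prod hQ).exists_isFaceOf ?_
      obtain ⟨a, ha, b, hb, hab⟩ := hPv
      obtain ⟨c, hc⟩ := hQv.nonempty
      refine ⟨_, toLp_mem_l2Prod ha.1 hc.1, _, toLp_mem_l2Prod hb.1 hc.1, fun h => hab ?_⟩
      exact congrArg WithLp.fst h
    refine closure_minimal (t := Set.Ici _) ?_ isClosed_Ici
      ((hP.l2Prod hQ).pyramidalWidth_mem_closure hface)
    rintro _ ⟨h, p, z, hh, hp, hz, rfl⟩
    obtain ⟨t, ht⟩ := exists_pyramidalWidth_sq_le_dist_sq hP hQ hh hp hz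
    exact (pow_le_pow_iff_left₀ (by positivity) dist_nonneg two_ne_zero).1
      ((div_sqrt_sq_le t).trans ht)
end

section
/- Let P ⊆ E and Q ⊆ F be polytopes of dimension at least 1 in finite-dimensional real inner product spaces, and let F_P be a facet of P. Then F_P × Q is a facet of the product P × Q (with the ℓ² product norm), and the inner vertex-facet distances agree: vf(P × Q, F_P × Q) = vf(P, F_P). -/
section Defs

variable {E : Type*} [NormedAddCommGroup E] [InnerProductSpace ℝ E]

/-- The dimension of a set: the rank of the direction of its affine span. -/
noncomputable def setDim (S : Set E) : ℕ :=
  Module.finrank ℝ (affineSpan ℝ S).direction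

/-- A facet of `P`: a nonempty proper exposed face of dimension `dim(P) − 1`. -/
def IsFacetOf (P F : Set E) : Prop :=
  IsExposed ℝ P F ∧ F.Nonempty ∧ F ≠ P ∧ setDim F + 1 = setDim P

/-- The inner vertex-facet distance `vf(P, F) = dist(aff(F), V(P) \ V(F))`, where `V(·)`
denotes the set of extreme points. -/
noncomputable def innerVertexFacetDist (P F : Set E) : ℝ :=
  setDist (affineSpan ℝ F : Set E) (P.extremePoints ℝ \ F.extremePoints ℝ)

end Defs

section Product

variable {E F : Type*} [NormedAddCommGroup E] [InnerProductSpace ℝ E]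
  [NormedAddCommGroup F] [InnerProductSpace ℝ F]

theorem IsPolytope.nonempty {S : Set E} (hS : IsPolytope S) : S.Nonempty := by
  obtain ⟨V, -, hV, rfl⟩ := hS
  exact convexHull_nonempty_iff.2 hV

theorem IsPolytope.isCompact_s7 {S : Set E} (hS : IsPolytope S) : IsCompact S := by
  obtain ⟨V, hV, -, rfl⟩ := hS
  exact hV.isCompact_convexHull ℝ

theorem IsPolytope.extremePoints_nonempty {S : Set E} (hS : IsPolytope S) :
    (S.extremePoints ℝ).Nonempty :=
  hS.isCompact_s7.extremePoints_nonempty hS.nonempty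

theorem setDist_le_setDist {X Y : Type*} [PseudoMetricSpace X] [PseudoMetricSpace Y]
    {A B : Set X} {C D : Set Y} (hne : (A ×ˢ B).Nonempty)
    (h : ∀ a ∈ A, ∀ b ∈ B, ∃ c ∈ C, ∃ d ∈ D, dist c d ≤ dist a b) :
    setDist C D ≤ setDist A B := by
  refine le_csInf (hne.image _) ?_
  rintro _ ⟨⟨a, b⟩, ⟨ha, hb⟩, rfl⟩
  obtain ⟨c, hc, d, hd, hle⟩ := h a ha b hb
  have hbdd : BddBelow ((fun p : Y × Y => dist p.1 p.2) '' (C ×ˢ D)) := by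
    refine ⟨0, ?_⟩
    rintro _ ⟨p, -, rfl⟩
    exact dist_nonneg
  exact (csInf_le hbdd (Set.mem_image_of_mem _ (Set.mk_mem_prod hc hd))).trans hle

/-- If every distance realized between `C` and `D` dominates one between `A` and `B`, and every
distance realized between `A` and `B` dominates one between `C` and `D`, the two set distances
agree. -/
theorem setDist_eq_of_forall_exists_le {X Y : Type*} [PseudoMetricSpace X] [PseudoMetricSpace Y]
    {A B : Set X} {C D : Set Y}
    (h₁ : ∀ c ∈ C, ∀ d ∈ D, ∃ a ∈ A, ∃ b ∈ B, dist a b ≤ dist c d)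
    (h₂ : ∀ a ∈ A, ∀ b ∈ B, ∃ c ∈ C, ∃ d ∈ D, dist c d ≤ dist a b) :
    setDist A B = setDist C D := by
  rcases (A ×ˢ B).eq_empty_or_nonempty with hAB | hAB
  · have hCD : C ×ˢ D = ∅ := by
      refine Set.eq_empty_of_forall_notMem fun p hp => ?_
      obtain ⟨a, ha, b, hb, -⟩ := h₁ p.1 hp.1 p.2 hp.2
      exact (hAB.subset (Set.mk_mem_prod ha hb) : (a, b) ∈ (∅ : Set _))
    simp [setDist, hAB, hCD]
  · have hCD : (C ×ˢ D).Nonempty := by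
      obtain ⟨p, hp⟩ := hAB
      obtain ⟨c, hc, d, hd, -⟩ := h₂ p.1 hp.1 p.2 hp.2
      exact ⟨(c, d), hc, hd⟩
    exact (setDist_le_setDist hCD h₁).antisymm (setDist_le_setDist hAB h₂)

theorem affineSpan_withLp_prod (A : Set E) (B : Set F) :
    (affineSpan ℝ ((WithLp.equiv 2 (E × F)).symm '' (A ×ˢ B)) : Set (WithLp 2 (E × F))) =
      (WithLp.equiv 2 (E × F)).symm '' ((affineSpan ℝ A : Set E) ×ˢ (affineSpan ℝ B : Set F)) := by
  have h := AffineSubspace.map_span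
    (WithLp.linearEquiv 2 ℝ (E × F)).symm.toLinearMap.toAffineMap (A ×ˢ B)
  rw [affineSpan_prod_eq] at h
  exact (congrArg (fun S : AffineSubspace ℝ (WithLp 2 (E × F)) =>
    (S : Set (WithLp 2 (E × F)))) h).symm

theorem finrank_submodule_prod {K V W : Type*} [DivisionRing K] [AddCommGroup V] [Module K V]
    [AddCommGroup W] [Module K W] (p : Submodule K V) (q : Submodule K W)
    [FiniteDimensional K p] [FiniteDimensional K q] :
    Module.finrank K (p.prod q) = Module.finrank K p + Module.finrank K q := by
  let e : p.prod q ≃ₗ[K] p × q :=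
    { toFun := fun x => (⟨x.1.1, x.2.1⟩, ⟨x.1.2, x.2.2⟩)
      invFun := fun x => ⟨(x.1, x.2), x.1.2, x.2.2⟩
      map_add' := fun _ _ => rfl
      map_smul' := fun _ _ => rfl }
  rw [e.finrank_eq, Module.finrank_prod]

theorem setDim_withLp_prod [FiniteDimensional ℝ E] [FiniteDimensional ℝ F]
    {A : Set E} {B : Set F} (hA : A.Nonempty) (hB : B.Nonempty) :
    setDim ((WithLp.equiv 2 (E × F)).symm '' (A ×ˢ B)) = setDim A + setDim B := by
  have h := AffineMap.map_vectorSpan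
    (WithLp.linearEquiv 2 ℝ (E × F)).symm.toLinearMap.toAffineMap (s := A ×ˢ B)
  rw [vectorSpan_prod_eq hA hB] at h
  unfold setDim
  rw [direction_affineSpan, direction_affineSpan, direction_affineSpan]
  refine (congrArg (fun S : Submodule ℝ (WithLp 2 (E × F)) => Module.finrank ℝ S) h).symm.trans ?_
  refine (LinearEquiv.finrank_map_eq (WithLp.linearEquiv 2 ℝ (E × F)).symm _).trans ?_
  exact finrank_submodule_prod _ _

theorem extremePoints_withLp_prod (A : Set E) (B : Set F) :
    ((WithLp.equiv 2 (E × F)).symm '' (A ×ˢ B)).extremePoints ℝ =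
      (WithLp.equiv 2 (E × F)).symm '' (A.extremePoints ℝ ×ˢ B.extremePoints ℝ) := by
  rw [← extremePoints_prod]
  exact (image_extremePoints (𝕜 := ℝ) (WithLp.linearEquiv 2 ℝ (E × F)).symm (A ×ˢ B)).symm

theorem IsExposed.withLp_prod_right {P FP : Set E} (h : IsExposed ℝ P FP) (Q : Set F) :
    IsExposed ℝ ((WithLp.equiv 2 (E × F)).symm '' (P ×ˢ Q))
      ((WithLp.equiv 2 (E × F)).symm '' (FP ×ˢ Q)) := by
  rintro ⟨_, ⟨a, b⟩, ⟨ha, hb⟩, rfl⟩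
  obtain ⟨l, hl⟩ := h ⟨a, ha⟩
  refine ⟨l.comp (WithLp.fstL 2 ℝ E F), ?_⟩
  subst hl
  ext z
  constructor
  · rintro ⟨⟨x, y⟩, ⟨⟨hx, hmax⟩, hy⟩, rfl⟩
    refine ⟨⟨(x, y), ⟨hx, hy⟩, rfl⟩, ?_⟩
    rintro _ ⟨⟨x', y'⟩, ⟨hx', -⟩, rfl⟩
    exact hmax x' hx'
  · rintro ⟨⟨⟨x, y⟩, ⟨hx, hy⟩, rfl⟩, hmax⟩
    exact ⟨(x, y), ⟨⟨hx, fun x' hx' => hmax _ ⟨(x', y), ⟨hx', hy⟩, rfl⟩⟩, hy⟩, rfl⟩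

theorem IsFacetOf.withLp_prod_right [FiniteDimensional ℝ E] [FiniteDimensional ℝ F]
    {P FP : Set E} (h : IsFacetOf P FP) {Q : Set F} (hP : P.Nonempty) (hQ : Q.Nonempty) :
    IsFacetOf ((WithLp.equiv 2 (E × F)).symm '' (P ×ˢ Q))
      ((WithLp.equiv 2 (E × F)).symm '' (FP ×ˢ Q)) := by
  obtain ⟨hexp, hne, hproper, hdim⟩ := h
  refine ⟨hexp.withLp_prod_right Q, (hne.prod hQ).image _, fun heq => hproper ?_, ?_⟩
  · have h := (WithLp.equiv 2 (E × F)).symm.injective.image_injective heq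
    exact ((Set.prod_eq_prod_iff_of_nonempty (hne.prod hQ)).1 h).1
  · rw [setDim_withLp_prod hne hQ, setDim_withLp_prod hP hQ]
    omega

theorem dist_fst_le_dist_withLp {X Y : Type*} [SeminormedAddCommGroup X]
    [SeminormedAddCommGroup Y] (z w : WithLp 2 (X × Y)) :
    dist z.fst w.fst ≤ dist z w := by
  rw [WithLp.prod_dist_eq_of_L2]
  exact Real.le_sqrt_of_sq_le (le_add_of_nonneg_right (sq_nonneg _))

theorem innerVertexFacetDist_withLp_prod (P FP : Set E) {Q : Set F}
    (hQ : (Q.extremePoints ℝ).Nonempty) :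
    innerVertexFacetDist ((WithLp.equiv 2 (E × F)).symm '' (P ×ˢ Q))
        ((WithLp.equiv 2 (E × F)).symm '' (FP ×ˢ Q)) = innerVertexFacetDist P FP := by
  obtain ⟨q, hq⟩ := hQ
  unfold innerVertexFacetDist
  rw [extremePoints_withLp_prod, extremePoints_withLp_prod,
    ← Set.image_sdiff (WithLp.equiv 2 (E × F)).symm.injective, Set.prod_sdiff_prod,
    Set.sdiff_self, Set.prod_empty, Set.empty_union, affineSpan_withLp_prod]
  apply setDist_eq_of_forall_exists_le
  · intro a ha v hv
    refine ⟨_, ⟨(a, q), ⟨ha, subset_affineSpan ℝ _ hq.1⟩, rfl⟩, _, ⟨(v, q), ⟨hv, hq⟩, rfl⟩, ?_⟩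
    rw [WithLp.prod_dist_eq_of_L2]
    simp
  · rintro _ ⟨⟨a, b⟩, ⟨ha, -⟩, rfl⟩ _ ⟨⟨v, w⟩, ⟨hv, -⟩, rfl⟩
    exact ⟨a, ha, v, hv, dist_fst_le_dist_withLp ((WithLp.equiv 2 (E × F)).symm (a, b))
      ((WithLp.equiv 2 (E × F)).symm (v, w))⟩

end Product

/-- For polytopes `P ⊆ E`, `Q ⊆ F` of dimension at least `1` and a facet `F_P` of `P`,
the set `F_P × Q` is a facet of `P × Q` (in `E × F` with the ℓ² product norm), and the
inner vertex-facet distances agree: `vf(P × Q, F_P × Q) = vf(P, F_P)`. -/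
theorem innerVertexFacetDist_prod
    {E F : Type*} [NormedAddCommGroup E] [InnerProductSpace ℝ E] [FiniteDimensional ℝ E]
    [NormedAddCommGroup F] [InnerProductSpace ℝ F] [FiniteDimensional ℝ F]
    (P : Set E) (Q : Set F) (hP : IsPolytope P) (hQ : IsPolytope Q)
    (hPdim : 1 ≤ setDim P) (hQdim : 1 ≤ setDim Q)
    (FP : Set E) (hFP : IsFacetOf P FP) :
    IsFacetOf ((WithLp.equiv 2 (E × F)).symm '' (P ×ˢ Q))
        ((WithLp.equiv 2 (E × F)).symm '' (FP ×ˢ Q)) ∧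
    innerVertexFacetDist ((WithLp.equiv 2 (E × F)).symm '' (P ×ˢ Q))
        ((WithLp.equiv 2 (E × F)).symm '' (FP ×ˢ Q)) =
      innerVertexFacetDist P FP := by
  exact ⟨hFP.withLp_prod_right hP.nonempty hQ.nonempty,
    innerVertexFacetDist_withLp_prod P FP hQ.extremePoints_nonempty⟩
end
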